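/- arXiv:2307.11249 — 10 statements merged into one kernel-verified Lean document; each statement's English description precedes it below -/
import Mathlib

section
/- Let X be a nonempty finite type, let p, q : X → ℝ be strictly positive functions with ∑ₓ p(x) = 1 and ∑ₓ q(x) = 1, and let A : X → ℝ satisfy ∑ₓ A(x) = 0. Then the function t ↦ ∑ₓ q(x) · ln(q(x) / (p(x) + t·A(x))) has derivative at t = 0 equal to ∑ₓ (1/p(x)) · (p(x) − q(x)) · A(x). (That is, the Fisher-Rao gradient of the Kullback–Leibler divergence D(q ‖ ·) at p is the tangent vector p − q.) -/
/-- Each summand of `D(q ‖ p + t A)`, as a function of `t`, has derivative `-(b * a / c)` at `0`,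
where `b`, `c` and `a` are the values of `q`, `p` and `A`. -/
theorem hasDerivAt_mul_log_div_add_mul {b c : ℝ} (hb : b ≠ 0) (hc : c ≠ 0) (a : ℝ) :
    HasDerivAt (fun t : ℝ => b * Real.log (b / (c + t * a))) (-(b * a / c)) 0 := by
  have hlin : HasDerivAt (fun t : ℝ => c + t * a) a 0 := by
    simpa using ((hasDerivAt_id (0 : ℝ)).mul_const a).const_add c
  have hc' : c + 0 * a ≠ 0 := by simpa using hc
  have hdiv := (hasDerivAt_const (0 : ℝ) b).fun_div hlin hc'
  refine ((hdiv.log (div_ne_zero hb hc')).const_mul b).congr_deriv ?_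
  simp only [zero_mul, add_zero]
  field_simp
  ring

/-- The Fisher-Rao gradient of the Kullback–Leibler divergence `D(q ‖ ·)` at `p`
is the tangent vector `p − q`: the directional derivative of `D(q ‖ ·)` at `p`
along a tangent vector `A` equals the Fisher-Rao inner product of `p − q` with `A`. -/
theorem fisherRao_gradient_KL_second_argument
    {X : Type*} [Fintype X] [Nonempty X]
    (p q : X → ℝ) (hp : ∀ x, 0 < p x) (hq : ∀ x, 0 < q x)
    (hps : ∑ x, p x = 1) (hqs : ∑ x, q x = 1)
    (A : X → ℝ) (hA : ∑ x, A x = 0) :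
    HasDerivAt (fun t : ℝ => ∑ x, q x * Real.log (q x / (p x + t * A x)))
      (∑ x, (1 / p x) * (p x - q x) * A x) 0 := by
  have hsum : ∑ x, (1 / p x) * (p x - q x) * A x = ∑ x, -(q x * A x / p x) := by
    rw [← sub_eq_zero, ← Finset.sum_sub_distrib, ← hA]
    refine Finset.sum_congr rfl fun x _ => ?_
    have := (hp x).ne'
    field_simp
    ring
  rw [hsum]
  exact HasDerivAt.fun_sum fun x _ =>
    hasDerivAt_mul_log_div_add_mul (hq x).ne' (hp x).ne' (A x)
end

section
/- Let X be a nonempty finite type, let p, q : X → ℝ be strictly positive functions with ∑ₓ p(x) = 1 and ∑ₓ q(x) = 1, and let A : X → ℝ satisfy ∑ₓ A(x) = 0. Then the function t ↦ ∑ₓ (q(x) + t·A(x)) · ln((q(x) + t·A(x)) / p(x)) has derivative at t = 0 equal to ∑ₓ (1/q(x)) · G(x) · A(x), where G(x) := q(x) · ( ln(q(x)/p(x)) − ∑_{x'} q(x') ln(q(x')/p(x')) ). (That is, the Fisher-Rao gradient of D(· ‖ p) at q is the tangent vector x ↦ q(x)(ln(q(x)/p(x)) − E_q[ln(q/p)]).)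 -/
/-- The derivative at `0` of the summand `t ↦ (b + t a) ln ((b + t a) / c)` of the
Kullback–Leibler divergence along a line. -/
theorem hasDerivAt_mul_log_div_line {b c : ℝ} (hb : b ≠ 0) (hc : c ≠ 0) (a : ℝ) :
    HasDerivAt (fun t : ℝ => (b + t * a) * Real.log ((b + t * a) / c))
      (a * Real.log (b / c) + a) 0 := by
  have hline : HasDerivAt (fun t : ℝ => b + t * a) a 0 := by
    simpa using ((hasDerivAt_id (0 : ℝ)).mul_const a).const_add b
  have hlog := (hline.div_const c).log (by simp [hb, hc])
  refine (hline.fun_mul hlog).congr_deriv ?_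
  simp only [zero_mul, add_zero]
  field_simp

/-- The Fisher-Rao gradient of the Kullback–Leibler divergence `D(· ‖ p)` at `q`
is the tangent vector `x ↦ q x * (ln (q x / p x) − E_q[ln (q/p)])`: the directional
derivative of `D(· ‖ p)` at `q` along a tangent vector `A` equals the Fisher-Rao
inner product of this gradient with `A`. -/
theorem fisherRao_gradient_KL_first_argument
    {X : Type*} [Fintype X] [Nonempty X]
    (p q : X → ℝ) (hp : ∀ x, 0 < p x) (hq : ∀ x, 0 < q x)
    (hps : ∑ x, p x = 1) (hqs : ∑ x, q x = 1)
    (A : X → ℝ) (hA : ∑ x, A x = 0) :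
    HasDerivAt (fun t : ℝ => ∑ x, (q x + t * A x) * Real.log ((q x + t * A x) / p x))
      (∑ x, (1 / q x) *
        (q x * (Real.log (q x / p x) - ∑ x', q x' * Real.log (q x' / p x'))) * A x) 0 := by
  have hderiv := HasDerivAt.fun_sum (u := Finset.univ) fun x _ =>
    hasDerivAt_mul_log_div_line (hq x).ne' (hp x).ne' (A x)
  refine hderiv.congr_deriv ?_
  symm
  set E := ∑ x', q x' * Real.log (q x' / p x')
  have hterm : ∀ x, (1 / q x) * (q x * (Real.log (q x / p x) - E)) * A x
      = A x * Real.log (q x / p x) - E * A x := fun x => by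
    have := (hq x).ne'
    field_simp
  simp only [hterm, Finset.sum_sub_distrib, Finset.sum_add_distrib, ← Finset.mul_sum, hA]
  ring
end

section
/- Let V and H be nonempty finite types, let p : V × H → ℝ be strictly positive with total sum 1, let p* : V → ℝ be strictly positive with sum 1, and let A : V × H → ℝ satisfy ∑_{(x_V,x_H)} A(x_V,x_H) = 0. Define the marginal p(x_V) = ∑_{x_H} p(x_V,x_H) and π_Q(p)(x_V,x_H) = p*(x_V) · p(x_V,x_H)/p(x_V). Then the function t ↦ ∑_{x_V} p*(x_V) · ln( p*(x_V) / ∑_{x_H} (p(x_V,x_H) + t·A(x_V,x_H)) ) has derivative at t = 0 equal to ∑_{(x_V,x_H)} (1/p(x_V,x_H)) · (p(x_V,x_H) − π_Q(p)(x_V,x_H)) · A(x_V,x_H). (Theorem 2(a): the Fisher-Rao gradient of D(𝒬 ‖ ·) = D(p* ‖ π_V(·)) at p on the full simplex is p − π_Q(p).) -/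
/-- Theorem 2(a): the Fisher-Rao gradient of `D(𝒬 ‖ ·) = D(p* ‖ π_V(·))` at a joint
distribution `p` on the full simplex is `p − π_Q(p)`, where
`π_Q(p)(x_V,x_H) = p*(x_V) · p(x_V,x_H) / p(x_V)`. -/
theorem fisherRao_gradient_D_Q
    {V H : Type*} [Fintype V] [Fintype H] [Nonempty V] [Nonempty H]
    (p : V × H → ℝ) (hp : ∀ x, 0 < p x) (hps : ∑ x, p x = 1)
    (pstar : V → ℝ) (hpstar : ∀ xV, 0 < pstar xV) (hpstars : ∑ xV, pstar xV = 1)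
    (A : V × H → ℝ) (hA : ∑ x, A x = 0) :
    HasDerivAt
      (fun t : ℝ => ∑ xV, pstar xV *
        Real.log (pstar xV / ∑ xH, (p (xV, xH) + t * A (xV, xH))))
      (∑ x : V × H, (1 / p x) *
        (p x - pstar x.1 * p x / ∑ xH, p (x.1, xH)) * A x) 0 := by
  have hpos (v : V) : 0 < ∑ h, p (v, h) :=
    Finset.sum_pos (fun h _ => hp (v, h)) Finset.univ_nonempty
  have hgrad : ∑ x : V × H, (1 / p x) * (p x - pstar x.1 * p x / ∑ h, p (x.1, h)) * A x =
      ∑ v, pstar v * -((∑ h, A (v, h)) / ∑ h, p (v, h)) := by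
    have hterm (x : V × H) : (1 / p x) * (p x - pstar x.1 * p x / ∑ h, p (x.1, h)) * A x =
        A x - pstar x.1 / (∑ h, p (x.1, h)) * A x := by
      have := (hp x).ne'
      have := (hpos x.1).ne'
      field_simp
    simp_rw [hterm, Finset.sum_sub_distrib, hA, Fintype.sum_prod_type, ← Finset.mul_sum,
      zero_sub, ← Finset.sum_neg_distrib]
    exact Finset.sum_congr rfl fun v _ => by ring
  rw [hgrad]
  refine HasDerivAt.fun_sum fun v _ => HasDerivAt.const_mul _ ?_
  have hmarg : HasDerivAt (fun t : ℝ => ∑ h, (p (v, h) + t * A (v, h))) (∑ h, A (v, h)) 0 :=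
    HasDerivAt.fun_sum fun h _ => by
      simpa using ((hasDerivAt_id (0 : ℝ)).mul_const (A (v, h))).const_add (p (v, h))
  have hzero : ∑ h, (p (v, h) + 0 * A (v, h)) = ∑ h, p (v, h) := by simp
  have hne : ∑ h, (p (v, h) + 0 * A (v, h)) ≠ 0 := hzero ▸ (hpos v).ne'
  have hlog := ((hasDerivAt_const (0 : ℝ) (pstar v)).fun_div hmarg hne).log
    (div_ne_zero (hpstar v).ne' hne)
  refine hlog.congr_deriv ?_
  rw [hzero]
  have := (hpstar v).ne'
  have := (hpos v).ne'
  field_simp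
  ring
end

section
/- Let V and H be nonempty finite types, let p : V × H → ℝ be strictly positive with total sum 1, and let p* : V → ℝ be strictly positive with sum 1. With p(x_V) = ∑_{x_H} p(x_V,x_H) and π_Q(p)(x_V,x_H) = p*(x_V)·p(x_V,x_H)/p(x_V), one has D(π_Q(p) ‖ p) = D(p* ‖ π_V(p)), i.e. ∑_{(x_V,x_H)} π_Q(p)(x_V,x_H) · ln( π_Q(p)(x_V,x_H) / p(x_V,x_H) ) = ∑_{x_V} p*(x_V) · ln( p*(x_V) / p(x_V) ). -/
/-- `D(π_Q(p) ‖ p) = D(p* ‖ π_V(p))`: the KL-divergence of the projection of `p`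
onto the data manifold from `p` equals the KL-divergence of the target `p*` from
the marginal of `p`. -/
theorem KL_projection_eq_KL_marginal
    {V H : Type*} [Fintype V] [Fintype H] [Nonempty V] [Nonempty H]
    (p : V × H → ℝ) (hp : ∀ x, 0 < p x) (hps : ∑ x, p x = 1)
    (pstar : V → ℝ) (hpstar : ∀ xV, 0 < pstar xV) (hpstars : ∑ xV, pstar xV = 1) :
    ∑ x : V × H,
      (pstar x.1 * p x / ∑ xH, p (x.1, xH)) *
        Real.log ((pstar x.1 * p x / ∑ xH, p (x.1, xH)) / p x)
      = ∑ xV, pstar xV * Real.log (pstar xV / ∑ xH, p (xV, xH)) := by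
  rw [Fintype.sum_prod_type]
  refine Finset.sum_congr rfl fun v _ => ?_
  have hm : ∑ h, p (v, h) ≠ 0 :=
    (Finset.sum_pos (fun h _ => hp (v, h)) Finset.univ_nonempty).ne'
  have hratio (h : H) :
      pstar v * p (v, h) / (∑ k, p (v, k)) / p (v, h) = pstar v / ∑ k, p (v, k) := by
    rw [div_right_comm, mul_div_cancel_right₀ _ (hp (v, h)).ne']
  simp only [hratio]
  rw [← Finset.sum_mul, ← Finset.sum_div, ← Finset.mul_sum, mul_div_cancel_right₀ _ hm]
end

section
/- Let V and H be nonempty finite types, let p, q : V × H → ℝ be strictly positive with total sum 1, let p* : V → ℝ be strictly positive with sum 1, and suppose ∑_{x_H} q(x_V,x_H) = p*(x_V) for all x_V. With π_Q(p)(x_V,x_H) = p*(x_V)·p(x_V,x_H)/p(x_V) where p(x_V) = ∑_{x_H} p(x_V,x_H), the Pythagorean identity holds: D(q ‖ p) = D(q ‖ π_Q(p)) + D(π_Q(p) ‖ p). -/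
/-- Joint weights with the same first marginal integrate functions of the first coordinate
equally. -/
theorem sum_mul_comp_fst_eq_of_marginal_eq {V H R : Type*} [Fintype V] [Fintype H]
    [NonUnitalNonAssocSemiring R] {r s : V × H → R}
    (h : ∀ v, ∑ y, r (v, y) = ∑ y, s (v, y)) (f : V → R) :
    ∑ x, r x * f x.1 = ∑ x, s x * f x.1 := by
  simp only [Fintype.sum_prod_type, ← Finset.sum_mul, h]

/-- Pythagorean identity: for `q` in the data manifold (marginal of `q` is `p*`) and
`π_Q(p)(x_V,x_H) = p*(x_V)·p(x_V,x_H)/p(x_V)`, one has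
`D(q ‖ p) = D(q ‖ π_Q(p)) + D(π_Q(p) ‖ p)`. -/
theorem KL_pythagorean_identity
    {V H : Type*} [Fintype V] [Fintype H] [Nonempty V] [Nonempty H]
    (p q : V × H → ℝ) (hp : ∀ x, 0 < p x) (hq : ∀ x, 0 < q x)
    (hps : ∑ x, p x = 1) (hqs : ∑ x, q x = 1)
    (pstar : V → ℝ) (hpstar : ∀ xV, 0 < pstar xV) (hpstars : ∑ xV, pstar xV = 1)
    (hmarg : ∀ xV, ∑ xH, q (xV, xH) = pstar xV) :
    ∑ x : V × H, q x * Real.log (q x / p x)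
      = (∑ x : V × H, q x * Real.log (q x / (pstar x.1 * p x / ∑ xH, p (x.1, xH))))
        + ∑ x : V × H,
            (pstar x.1 * p x / ∑ xH, p (x.1, xH)) *
              Real.log ((pstar x.1 * p x / ∑ xH, p (x.1, xH)) / p x) := by
  have hpV : ∀ v, 0 < ∑ y, p (v, y) := fun v =>
    Finset.sum_pos (fun y _ => hp (v, y)) Finset.univ_nonempty
  have hratio : ∀ x : V × H, (pstar x.1 * p x / ∑ y, p (x.1, y)) / p x
      = pstar x.1 / ∑ y, p (x.1, y) := fun x => by
    have := (hp x).ne'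
    field_simp
  have hmarg_proj : ∀ v, ∑ y, q (v, y) = ∑ y, pstar v * p (v, y) / ∑ z, p (v, z) := fun v => by
    rw [hmarg, ← Finset.sum_div, ← Finset.mul_sum, mul_div_cancel_right₀ _ (hpV v).ne']
  simp only [hratio]
  rw [← sum_mul_comp_fst_eq_of_marginal_eq (r := q)
      (s := fun x => pstar x.1 * p x / ∑ y, p (x.1, y)) hmarg_proj
      (fun v => Real.log (pstar v / ∑ y, p (v, y))), ← Finset.sum_add_distrib]
  refine Finset.sum_congr rfl fun x _ => ?_
  have hproj : 0 < pstar x.1 * p x / ∑ y, p (x.1, y) :=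
    div_pos (mul_pos (hpstar x.1) (hp x)) (hpV x.1)
  rw [← mul_add, ← hratio x,
    ← Real.log_mul (div_pos (hq x) hproj).ne' (div_pos hproj (hp x)).ne',
    div_mul_div_cancel₀ hproj.ne']
end

section
/- Let V and H be nonempty finite types, let p : V × H → ℝ be strictly positive with total sum 1, and let p* : V → ℝ be strictly positive with sum 1. Set π_Q(p)(x_V,x_H) = p*(x_V)·p(x_V,x_H)/p(x_V) with p(x_V) = ∑_{x_H} p(x_V,x_H). Then the tangent vector p − π_Q(p) is horizontal: for every A : V × H → ℝ with ∑_{x_H} A(x_V,x_H) = 0 for all x_V, the Fisher-Rao inner product vanishes, ∑_{(x_V,x_H)} (1/p(x_V,x_H)) · (p(x_V,x_H) − π_Q(p)(x_V,x_H)) · A(x_V,x_H) = 0. -/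
/-- The tangent vector `p − π_Q(p)` is horizontal: it is Fisher-Rao orthogonal to
every vertical vector `A` (one with `∑_{x_H} A (x_V, x_H) = 0` for all `x_V`). -/
theorem grad_D_Q_is_horizontal
    {V H : Type*} [Fintype V] [Fintype H] [Nonempty V] [Nonempty H]
    (p : V × H → ℝ) (hp : ∀ x, 0 < p x) (hps : ∑ x, p x = 1)
    (pstar : V → ℝ) (hpstar : ∀ xV, 0 < pstar xV) (hpstars : ∑ xV, pstar xV = 1)
    (A : V × H → ℝ) (hA : ∀ xV, ∑ xH, A (xV, xH) = 0) :
    ∑ x : V × H, (1 / p x) * (p x - pstar x.1 * p x / ∑ xH, p (x.1, xH)) * A x = 0 := by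
  rw [Fintype.sum_prod_type]
  refine Finset.sum_eq_zero fun v _ => ?_
  have h_factor : ∀ h, (1 / p (v, h)) * (p (v, h) - pstar v * p (v, h) / ∑ xH, p (v, xH)) *
      A (v, h) = (1 - pstar v / ∑ xH, p (v, xH)) * A (v, h) := fun h => by
    have h_ne : p (v, h) ≠ 0 := (hp (v, h)).ne'
    congr 1
    rw [mul_div_right_comm, ← one_sub_mul, mul_comm, mul_assoc, mul_one_div_cancel h_ne, mul_one]
  simp only [h_factor, ← Finset.mul_sum, hA, mul_zero]
end

section
/- Let V and H be nonempty finite types and let p : V × H → ℝ be strictly positive with total sum 1. A vector A : V × H → ℝ with ∑_{(x_V,x_H)} A(x_V,x_H) = 0 satisfies ∑_{(x_V,x_H)} (1/p(x_V,x_H)) · A(x_V,x_H) · B(x_V,x_H) = 0 for every B with ∑_{x_H} B(x_V,x_H) = 0 for all x_V, if and only if A(x_V,x_H) = (p(x_V,x_H)/p(x_V)) · ∑_{x_H'} A(x_V,x_H') for all (x_V,x_H), where p(x_V) = ∑_{x_H} p(x_V,x_H). Consequently every tangent vector A at p has a unique decomposition A = A^ℋ + A^𝒱 with A^ℋ(x_V,x_H)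 = (p(x_V,x_H)/p(x_V)) · ∑_{x_H'} A(x_V,x_H') horizontal and A^𝒱 = A − A^ℋ vertical. -/
/-- The horizontal part of `A` at `p`: the marginal of `A` on `V`, distributed over each fibre
according to the conditional distribution of `p`. -/
noncomputable def horizontalPart {V H : Type*} [Fintype H] (p A : V × H → ℝ) (x : V × H) : ℝ :=
  p x / (∑ xH, p (x.1, xH)) * ∑ xH, A (x.1, xH)

theorem horizontalPart_orthogonal {V H : Type*} [Fintype V] [Fintype H]
    {p : V × H → ℝ} (hp : ∀ x, 0 < p x) (A : V × H → ℝ)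
    {B : V × H → ℝ} (hB : ∀ xV, ∑ xH, B (xV, xH) = 0) :
    ∑ x, (1 / p x) * horizontalPart p A x * B x = 0 := by
  rw [Fintype.sum_prod_type]
  refine Finset.sum_eq_zero fun v _ => ?_
  calc ∑ h, (1 / p (v, h)) * horizontalPart p A (v, h) * B (v, h)
      = ∑ h, (∑ xH, A (v, xH)) / (∑ xH, p (v, xH)) * B (v, h) := by
        refine Finset.sum_congr rfl fun h _ => ?_
        have hne := (hp (v, h)).ne'
        simp only [horizontalPart]
        field_simp
    _ = 0 := by rw [← Finset.mul_sum, hB, mul_zero]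

theorem sum_sub_horizontalPart {V H : Type*} [Fintype H] [Nonempty H]
    {p : V × H → ℝ} (hp : ∀ x, 0 < p x) (A : V × H → ℝ) (v : V) :
    ∑ h, (A (v, h) - horizontalPart p A (v, h)) = 0 := by
  have hne : ∑ h, p (v, h) ≠ 0 :=
    (Finset.sum_pos (fun h _ => hp (v, h)) Finset.univ_nonempty).ne'
  simp only [horizontalPart, Finset.sum_sub_distrib, ← Finset.sum_mul, ← Finset.sum_div]
  rw [div_self hne, one_mul, sub_self]

theorem eq_horizontalPart_of_orthogonal {V H : Type*} [Fintype V] [Fintype H] [Nonempty H]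
    {p : V × H → ℝ} (hp : ∀ x, 0 < p x) {A : V × H → ℝ}
    (hA : ∀ B : V × H → ℝ, (∀ xV, ∑ xH, B (xV, xH) = 0) →
      ∑ x, (1 / p x) * A x * B x = 0) (x : V × H) :
    A x = horizontalPart p A x := by
  have hvert := sum_sub_horizontalPart hp A
  have hsq : ∑ x, (1 / p x) * (A x - horizontalPart p A x) ^ 2 = 0 := by
    have hsub := congrArg₂ (· - ·) (hA (fun x => A x - horizontalPart p A x) hvert)
      (horizontalPart_orthogonal hp A (B := fun x => A x - horizontalPart p A x) hvert)
    rw [← Finset.sum_sub_distrib, sub_zero] at hsub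
    rw [← hsub]
    exact Finset.sum_congr rfl fun x _ => by ring
  have hx := (Finset.sum_eq_zero_iff_of_nonneg fun x _ =>
    mul_nonneg (one_div_pos.mpr (hp x)).le (sq_nonneg _)).mp hsq x (Finset.mem_univ x)
  have hpx := (one_div_pos.mpr (hp x)).ne'
  exact sub_eq_zero.mp (pow_eq_zero_iff two_ne_zero |>.mp ((mul_eq_zero.mp hx).resolve_left hpx))

/-- A tangent vector `A` at `p` (with `∑ A = 0`) is horizontal — i.e. Fisher-Rao
orthogonal to every vertical vector `B` — if and only if it has the form
`A(x_V,x_H) = (p(x_V,x_H)/p(x_V)) · ∑_{x_H'} A(x_V,x_H')`. Consequently `A` has a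
unique decomposition `A = A^ℋ + A^𝒱` into a horizontal and a vertical part, given
explicitly by `A^ℋ(x_V,x_H) = (p(x_V,x_H)/p(x_V)) · ∑_{x_H'} A(x_V,x_H')` and
`A^𝒱 = A − A^ℋ`. -/
theorem horizontal_characterisation_and_decomposition
    {V H : Type*} [Fintype V] [Fintype H] [Nonempty V] [Nonempty H]
    (p : V × H → ℝ) (hp : ∀ x, 0 < p x) (hps : ∑ x, p x = 1)
    (A : V × H → ℝ) (hA : ∑ x, A x = 0) :
    ((∀ B : V × H → ℝ, (∀ xV, ∑ xH, B (xV, xH) = 0) →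
        ∑ x : V × H, (1 / p x) * A x * B x = 0) ↔
      (∀ x : V × H, A x = p x / (∑ xH, p (x.1, xH)) * ∑ xH', A (x.1, xH'))) ∧
    (∃! hv : (V × H → ℝ) × (V × H → ℝ),
      (∀ x : V × H, A x = hv.1 x + hv.2 x) ∧
      (∀ B : V × H → ℝ, (∀ xV, ∑ xH, B (xV, xH) = 0) →
        ∑ x : V × H, (1 / p x) * hv.1 x * B x = 0) ∧
      (∀ xV, ∑ xH, hv.2 (xV, xH) = 0)) ∧
    ((∀ B : V × H → ℝ, (∀ xV, ∑ xH, B (xV, xH) = 0) →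
        ∑ x : V × H, (1 / p x) *
          (p x / (∑ xH, p (x.1, xH)) * ∑ xH', A (x.1, xH')) * B x = 0) ∧
      (∀ xV, ∑ xH,
        (A (xV, xH) - p (xV, xH) / (∑ xH', p (xV, xH')) * ∑ xH', A (xV, xH')) = 0)) := by
  refine ⟨⟨fun h => eq_horizontalPart_of_orthogonal hp h, fun h B hB => ?_⟩,
    ⟨(horizontalPart p A, fun x => A x - horizontalPart p A x), ?_, ?_⟩,
    fun B hB => horizontalPart_orthogonal hp A hB, sum_sub_horizontalPart hp A⟩
  · have hAB := horizontalPart_orthogonal hp A hB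
    rwa [← show A = horizontalPart p A from funext h] at hAB
  · exact ⟨fun x => (add_sub_cancel _ _).symm,
      fun B hB => horizontalPart_orthogonal hp A hB, sum_sub_horizontalPart hp A⟩
  · rintro ⟨h, v⟩ ⟨hsum, hhor, hver⟩
    dsimp only at hsum hhor hver
    have hmarg : ∀ xV, ∑ xH, h (xV, xH) = ∑ xH, A (xV, xH) := fun xV => by
      simp only [hsum, Finset.sum_add_distrib, hver, add_zero]
    have hh : h = horizontalPart p A := funext fun x => by
      rw [eq_horizontalPart_of_orthogonal hp hhor x]
      simp only [horizontalPart, hmarg]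
    refine Prod.ext hh (funext fun x => ?_)
    change v x = A x - horizontalPart p A x
    rw [← hh, hsum x, add_sub_cancel_left]
end

section
/- Let V and H be nonempty finite types, let p, q : V × H → ℝ be strictly positive with total sum 1, let p* : V → ℝ be strictly positive with sum 1 and ∑_{x_H} q(x_V,x_H) = p*(x_V) for all x_V, and let A : V × H → ℝ satisfy ∑ A = 0. Define ELBO(q,p) = −∑_{(x_V,x_H)} q(x_V,x_H) · ln( (q(x_V,x_H)/p*(x_V)) / p(x_V,x_H) ). Then the function t ↦ ELBO(q, p + t·A) has derivative at t = 0 equal to ∑_{(x_V,x_H)} (1/p(x_V,x_H)) · (q(x_V,x_H) − p(x_V,x_H)) · A(x_V,x_H). (That is, the Fisher-Rao gradient of ELBO(q, ·) at p on the full simplex is q − p = −grad_p D(q ‖ ·).) -/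
/-- The derivative at `0` of `t ↦ log (c / (a + t * b))`, the logarithm of an affine function in the
denominator. -/
theorem hasDerivAt_log_const_div_affine {a c : ℝ} (ha : a ≠ 0) (hc : c ≠ 0) (b : ℝ) :
    HasDerivAt (fun t : ℝ => Real.log (c / (a + t * b))) (-(b / a)) 0 := by
  have hden : HasDerivAt (fun t : ℝ => a + t * b) b 0 := by
    simpa using ((hasDerivAt_id (0 : ℝ)).mul_const b).const_add a
  have hne : a + 0 * b ≠ 0 := by simpa using ha
  convert ((hasDerivAt_const (0 : ℝ) c).fun_div hden hne).log (div_ne_zero hc hne) using 1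
  simp only [zero_mul, add_zero]
  field_simp
  ring

/-- The Fisher-Rao gradient of `ELBO(q, ·)` at `p` on the full simplex is
`q − p = −grad_p D(q ‖ ·)`: the directional derivative of
`p ↦ ELBO(q,p) = −∑ q ln((q/p*) / p)` at `p` along a tangent vector `A` equals the
Fisher-Rao inner product of `q − p` with `A`. -/
theorem fisherRao_gradient_ELBO
    {V H : Type*} [Fintype V] [Fintype H] [Nonempty V] [Nonempty H]
    (p q : V × H → ℝ) (hp : ∀ x, 0 < p x) (hq : ∀ x, 0 < q x)
    (hps : ∑ x, p x = 1) (hqs : ∑ x, q x = 1)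
    (pstar : V → ℝ) (hpstar : ∀ xV, 0 < pstar xV) (hpstars : ∑ xV, pstar xV = 1)
    (hmarg : ∀ xV, ∑ xH, q (xV, xH) = pstar xV)
    (A : V × H → ℝ) (hA : ∑ x, A x = 0) :
    HasDerivAt
      (fun t : ℝ => -∑ x : V × H,
        q x * Real.log ((q x / pstar x.1) / (p x + t * A x)))
      (∑ x : V × H, (1 / p x) * (q x - p x) * A x) 0 := by
  refine HasDerivAt.congr_deriv (HasDerivAt.fun_sum fun x (_ : x ∈ Finset.univ) =>
    (hasDerivAt_log_const_div_affine (hp x).ne'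
      (div_pos (hq x) (hpstar x.1)).ne' (A x)).const_mul (q x)).fun_neg ?_
  have hterm : ∀ x, 1 / p x * (q x - p x) * A x = -(q x * -(A x / p x)) - A x := fun x => by
    have := (hp x).ne'
    field_simp
  simp only [hterm, Finset.sum_sub_distrib, Finset.sum_neg_distrib, hA, sub_zero]
end

section
/- Let V and H be nonempty finite types and let p : V × H → ℝ be strictly positive with total sum 1; write p(x_V) = ∑_{x_H} p(x_V,x_H). Let a, b : V → ℝ satisfy ∑_{x_V} p(x_V) a(x_V) = 0 and ∑_{x_V} p(x_V) b(x_V) = 0, and define the horizontal tangent vectors A(x_V,x_H) = p(x_V,x_H)·a(x_V) and B(x_V,x_H) = p(x_V,x_H)·b(x_V). Then the Fisher-Rao metric is preserved under marginalisation: ∑_{(x_V,x_H)} A(x_V,x_H)·B(x_V,x_H)/p(x_V,x_H) = ∑_{x_V} (∑_{x_H} A(x_V,x_H))·(∑_{x_H} B(x_V,x_H)) / p(x_V). (The marginalisation map is a Riemannian submersion for the Fisher-Rao metrics on the full simplices over V × H and V, restricted to horizontal vectors.) -/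
/-- The marginalisation map is a Riemannian submersion for the Fisher-Rao metrics on
the full simplices: for horizontal tangent vectors `A(x_V,x_H) = p(x_V,x_H)·a(x_V)`
and `B(x_V,x_H) = p(x_V,x_H)·b(x_V)`, the Fisher-Rao inner product of `A` and `B`
at `p` equals the Fisher-Rao inner product of their marginalisations at `π_V(p)`. -/
theorem riemannian_submersion_horizontal
    {V H : Type*} [Fintype V] [Fintype H] [Nonempty V] [Nonempty H]
    (p : V × H → ℝ) (hp : ∀ x, 0 < p x) (hps : ∑ x, p x = 1)
    (a b : V → ℝ)
    (ha : ∑ xV, (∑ xH, p (xV, xH)) * a xV = 0)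
    (hb : ∑ xV, (∑ xH, p (xV, xH)) * b xV = 0) :
    ∑ x : V × H, (p x * a x.1) * (p x * b x.1) / p x
      = ∑ xV, (∑ xH, p (xV, xH) * a xV) * (∑ xH, p (xV, xH) * b xV)
          / ∑ xH, p (xV, xH) := by
  rw [Fintype.sum_prod_type]
  refine Finset.sum_congr rfl fun v _ => ?_
  have hm : ∑ h, p (v, h) ≠ 0 :=
    (Finset.sum_pos (fun h _ => hp (v, h)) Finset.univ_nonempty).ne'
  have hterm (h : H) :
      (p (v, h) * a v) * (p (v, h) * b v) / p (v, h) = p (v, h) * (a v * b v) := by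
    have := (hp (v, h)).ne'
    field_simp
  simp only [hterm, ← Finset.sum_mul]
  field_simp
end

section
/- Let n be a natural number, and for each i ∈ Fin n let X i be a nonempty finite type. For each i ∈ Fin n let k i : ℝ → ((j : Fin n) → X j) → ℝ be a family of strictly positive kernels such that: (i) k i θ x depends only on the coordinates x_j with j ≤ i (if x_j = y_j for all j ≤ i then k i θ x = k i θ y); (ii) for every θ and every x, ∑_{a : X i} k i θ (Function.update x i a) = 1 (normalisation of the conditional of node i); (iii) for every x, the function θ ↦ k i θ x is differentiable. For a parameter vector θ : Fin n → ℝ define p θ x = ∏_{i} k i (θ i) x. Then for all s ≠ t in Fin n and every θ, the score vectors of distinct nodes are Fisher-Rao orthogonal: ∑_x (1 / p θ x) · (deriv (fun u ↦ p (Function.update θ s u) x) (θ s)) · (deriv (fun u ↦ p (Function.update θ t u) x) (θ t)) = 0. -/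
theorem sum_sum_update {ι : Type*} [Fintype ι] [DecidableEq ι] {X : ι → Type*}
    [∀ i, Fintype (X i)] (i : ι) (h : (∀ j, X j) → ℝ) :
    ∑ x : ∀ j, X j, ∑ a : X i, h (Function.update x i a) = Fintype.card (X i) * ∑ x, h x := by
  have hinv : Function.Involutive
      (fun q : (∀ j, X j) × X i => (Function.update q.1 i q.2, q.1 i)) := by
    rintro ⟨x, a⟩
    simp
  calc ∑ x : ∀ j, X j, ∑ a : X i, h (Function.update x i a)
      = ∑ q : (∀ j, X j) × X i, h (Function.update q.1 i q.2) :=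
        (Fintype.sum_prod_type (fun q : (∀ j, X j) × X i => h (Function.update q.1 i q.2))).symm
    _ = ∑ q : (∀ j, X j) × X i, h q.1 :=
        Fintype.sum_equiv hinv.toPerm _ _ fun _ => rfl
    _ = Fintype.card (X i) * ∑ x, h x := by
        rw [Fintype.sum_prod_type]
        simp [Finset.mul_sum]

/-- If every factor `f i` depends only on coordinates `j ≤ i` and has constant partial sum `c i`
over coordinate `i`, then a product of such factors, one of which has vanishing partial sum,
sums to zero. -/
theorem sum_prod_eq_zero_of_triangular {ι : Type*} [Fintype ι] [LinearOrder ι] {X : ι → Type*}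
    [∀ i, Fintype (X i)] [∀ i, Nonempty (X i)] (f : ι → (∀ j, X j) → ℝ) (c : ι → ℝ)
    (hdep : ∀ i x y, (∀ j ≤ i, x j = y j) → f i x = f i y)
    (hsum : ∀ i x, ∑ a : X i, f i (Function.update x i a) = c i)
    (S : Finset ι) (hS : ∃ t ∈ S, c t = 0) : ∑ x, ∏ i ∈ S, f i x = 0 := by
  induction S using Finset.induction_on_max with
  | empty => simp at hS
  | insert m S hm ih =>
    have hmS : m ∉ S := fun h => lt_irrefl m (hm m h)
    have key : (Fintype.card (X m) : ℝ) * ∑ x, ∏ i ∈ insert m S, f i x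
        = c m * ∑ x, ∏ i ∈ S, f i x := by
      rw [← sum_sum_update, Finset.mul_sum]
      refine Finset.sum_congr rfl fun x _ => ?_
      rw [← hsum m x, Finset.sum_mul]
      refine Finset.sum_congr rfl fun a _ => ?_
      rw [Finset.prod_insert hmS]
      congr 1
      refine Finset.prod_congr rfl fun i hi => hdep _ _ _ fun j hj => ?_
      exact Function.update_of_ne (hj.trans_lt (hm i hi)).ne _ _
    have hzero : c m * ∑ x, ∏ i ∈ S, f i x = 0 := by
      obtain ⟨t, ht, hct⟩ := hS
      rcases Finset.mem_insert.mp ht with rfl | ht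
      · rw [hct, zero_mul]
      · rw [ih ⟨t, ht, hct⟩, mul_zero]
    rw [hzero] at key
    exact (mul_eq_zero.mp key).resolve_left (Nat.cast_ne_zero.mpr Fintype.card_ne_zero)

theorem deriv_prod_update {ι : Type*} [Fintype ι] [DecidableEq ι] (g : ι → ℝ → ℝ) (θ : ι → ℝ)
    (s : ι) :
    deriv (fun u : ℝ => ∏ i, g i (Function.update θ s u i)) (θ s)
      = deriv (g s) (θ s) * ∏ i ∈ Finset.univ.erase s, g i (θ i) := by
  have h : (fun u : ℝ => ∏ i, g i (Function.update θ s u i))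
      = fun u => g s u * ∏ i ∈ Finset.univ.erase s, g i (θ i) := by
    funext u
    rw [← Finset.mul_prod_erase _ _ (Finset.mem_univ s), Function.update_self]
    congr 1
    refine Finset.prod_congr rfl fun i hi => ?_
    rw [Function.update_of_ne (Finset.ne_of_mem_erase hi)]
  rw [h, deriv_mul_const_field]

/-- For a Bayesian graphical model `p θ x = ∏ i, k i (θ i) x`, where each strictly
positive conditional kernel `k i` depends only on coordinates `j ≤ i`, is normalised
over the state of node `i`, and is differentiable in its own parameter, the score
(tangent basis) vectors belonging to distinct nodes `s ≠ t` are Fisher-Rao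
orthogonal. -/
theorem bayesian_network_scores_orthogonal
    (n : ℕ) (X : Fin n → Type*) [∀ i, Fintype (X i)] [∀ i, Nonempty (X i)]
    (k : ∀ _ : Fin n, ℝ → ((j : Fin n) → X j) → ℝ)
    (hpos : ∀ i θ x, 0 < k i θ x)
    (hdep : ∀ (i : Fin n) (θ : ℝ) (x y : (j : Fin n) → X j),
      (∀ j : Fin n, j ≤ i → x j = y j) → k i θ x = k i θ y)
    (hnorm : ∀ (i : Fin n) (θ : ℝ) (x : (j : Fin n) → X j),
      ∑ a : X i, k i θ (Function.update x i a) = 1)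
    (hdiff : ∀ (i : Fin n) (x : (j : Fin n) → X j),
      Differentiable ℝ fun θ : ℝ => k i θ x)
    (s t : Fin n) (hst : s ≠ t) (θ : Fin n → ℝ) :
    ∑ x : (j : Fin n) → X j,
      (1 / ∏ i, k i (θ i) x) *
        deriv (fun u : ℝ => ∏ i, k i ((Function.update θ s u) i) x) (θ s) *
        deriv (fun u : ℝ => ∏ i, k i ((Function.update θ t u) i) x) (θ t) = 0 := by
  classical
  let f : Fin n → ((j : Fin n) → X j) → ℝ := fun i x =>
    if i = s ∨ i = t then deriv (fun u => k i u x) (θ i) else k i (θ i) x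
  have hfdep : ∀ i x y, (∀ j ≤ i, x j = y j) → f i x = f i y := by
    intro i x y hxy
    have h : ∀ u, k i u x = k i u y := fun u => hdep i u x y hxy
    simp only [f, h]
  have hfsum : ∀ i x, ∑ a : X i, f i (Function.update x i a)
      = if i = s ∨ i = t then 0 else 1 := by
    intro i x
    by_cases hi : i = s ∨ i = t
    · simp only [f, if_pos hi]
      rw [← deriv_fun_sum fun a _ => (hdiff i (Function.update x i a)).differentiableAt]
      simp only [hnorm, deriv_const]
    · simp only [f, if_neg hi, hnorm]
  have hf := sum_prod_eq_zero_of_triangular f _ hfdep hfsum Finset.univ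
    ⟨t, Finset.mem_univ t, if_pos (Or.inr rfl)⟩
  rw [← hf]
  refine Finset.sum_congr rfl fun x _ => ?_
  have hs := deriv_prod_update (fun i u => k i u x) θ s
  have ht := deriv_prod_update (fun i u => k i u x) θ t
  have hts : t ∈ Finset.univ.erase s := Finset.mem_erase.mpr ⟨hst.symm, Finset.mem_univ t⟩
  have hst' : s ∈ Finset.univ.erase t := Finset.mem_erase.mpr ⟨hst, Finset.mem_univ s⟩
  have hrest : ∏ i ∈ (Finset.univ.erase s).erase t, f i x
      = ∏ i ∈ (Finset.univ.erase s).erase t, k i (θ i) x := by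
    refine Finset.prod_congr rfl fun i hi => if_neg ?_
    simp only [Finset.mem_erase] at hi
    tauto
  have hfs : f s x = deriv (fun u => k s u x) (θ s) := if_pos (Or.inl rfl)
  have hft : f t x = deriv (fun u => k t u x) (θ t) := if_pos (Or.inr rfl)
  rw [hs, ht, ← Finset.mul_prod_erase _ (fun i => k i (θ i) x) (Finset.mem_univ s),
    ← Finset.mul_prod_erase _ (fun i => k i (θ i) x) hts,
    ← Finset.mul_prod_erase _ (fun i => k i (θ i) x) hst', Finset.erase_right_comm (a := t) (b := s),
    ← Finset.mul_prod_erase _ (fun i => f i x) (Finset.mem_univ s),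
    ← Finset.mul_prod_erase _ (fun i => f i x) hts, hrest, hfs, hft]
  have hks := (hpos s (θ s) x).ne'
  have hkt := (hpos t (θ t) x).ne'
  have hR : ∏ i ∈ (Finset.univ.erase s).erase t, k i (θ i) x ≠ 0 :=
    Finset.prod_ne_zero_iff.mpr fun i _ => (hpos i (θ i) x).ne'
  field_simp
end
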